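/- There is no map c : Fin 8 → ℝ² such that any two distinct indices i, j satisfy dist (c i) (c j) ≥ 2 and dist (c 0) (c i) = 2 for every i ≠ 0. In other words, the star with 7 leaves admits no weak unit disk contact representation: there is no family of 8 unit disks with pairwise disjoint interiors in which one disk touches the other 7. -/

import Mathlib

/-- The star with 7 leaves admits no weak unit disk contact representation:
there is no family of 8 points in the Euclidean plane, pairwise at distance at
least 2, such that the first point is at distance exactly 2 from the other 7. -/
theorem no_weak_udcr_star_seven :
    ¬ ∃ c : Fin 8 → EuclideanSpace ℝ (Fin 2),
      (∀ i j : Fin 8, i ≠ j → 2 ≤ dist (c i) (c j)) ∧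
        (∀ i : Fin 8, i ≠ 0 → dist (c 0) (c i) = 2) := by
  rintro ⟨c, h1, h2⟩
  have hπ := Real.pi_pos
  have key : ∀ i : Fin 8, i ≠ 0 → ∃ t : ℝ, -Real.pi < t ∧ t ≤ Real.pi ∧
      c i 0 = c 0 0 + 2 * Real.cos t ∧ c i 1 = c 0 1 + 2 * Real.sin t := by
    intro i hi
    let z : ℂ := ⟨c i 0 - c 0 0, c i 1 - c 0 1⟩
    have hz : ‖z‖ = 2 := by
      rw [← h2 i hi, EuclideanSpace.dist_eq, Complex.norm_def, Complex.normSq_apply,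
        Fin.sum_univ_two, Real.dist_eq, Real.dist_eq, sq_abs, sq_abs]
      congr 1
      simp only [z]
      ring
    have hre := Complex.norm_mul_cos_arg z
    have him := Complex.norm_mul_sin_arg z
    rw [hz] at hre him
    refine ⟨z.arg, Complex.neg_pi_lt_arg z, Complex.arg_le_pi z, ?_, ?_⟩
    · rw [hre]; simp [z]
    · rw [him]; simp [z]
  have key' : ∀ i : Fin 7, ∃ t : ℝ, -Real.pi < t ∧ t ≤ Real.pi ∧
      c i.succ 0 = c 0 0 + 2 * Real.cos t ∧ c i.succ 1 = c 0 1 + 2 * Real.sin t :=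
    fun i => key i.succ (Fin.succ_ne_zero i)
  choose t ht1 ht2 hx hy using key'
  obtain ⟨i, -, j, -, hij, hc⟩ := Finset.exists_ne_map_eq_of_card_lt_of_maps_to
    (s := (Finset.univ : Finset (Fin 7))) (t := Finset.Icc (-2 : ℤ) 3)
    (f := fun i => ⌈t i / (Real.pi / 3)⌉) (by simp) (by
      intro i _
      have a : (-3 : ℝ) < t i / (Real.pi / 3) := by
        rw [lt_div_iff₀ (by positivity)]; linarith [ht1 i]
      have b : t i / (Real.pi / 3) ≤ 3 := by
        rw [div_le_iff₀ (by positivity)]; linarith [ht2 i]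
      have a' : (-3 : ℤ) < ⌈t i / (Real.pi / 3)⌉ := Int.lt_ceil.2 (by exact_mod_cast a)
      have b' : ⌈t i / (Real.pi / 3)⌉ ≤ (3 : ℤ) := Int.ceil_le.2 (by exact_mod_cast b)
      simp only [Finset.coe_Icc, Set.mem_Icc]
      omega)
  have hd : |t i - t j| < Real.pi / 3 := by
    have e : |t i / (Real.pi / 3) - t j / (Real.pi / 3)| < 1 := by
      have i1 := Int.le_ceil (t i / (Real.pi / 3))
      have i2 := Int.ceil_lt_add_one (t i / (Real.pi / 3))
      have j1 := Int.le_ceil (t j / (Real.pi / 3))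
      have j2 := Int.ceil_lt_add_one (t j / (Real.pi / 3))
      rw [hc] at i1 i2
      rw [abs_lt]; constructor <;> linarith
    rw [← sub_div, abs_div, abs_of_pos (by positivity : 0 < Real.pi / 3),
      div_lt_one (by positivity)] at e
    exact e
  have hcos : 1 / 2 < Real.cos (t i - t j) := by
    rw [← Real.cos_abs (t i - t j), ← Real.cos_pi_div_three]
    exact Real.cos_lt_cos_of_nonneg_of_le_pi (abs_nonneg _) (by linarith) hd
  have h := h1 i.succ j.succ (fun e => hij (Fin.succ_injective _ e))
  rw [EuclideanSpace.dist_eq, Real.le_sqrt' (by norm_num), Fin.sum_univ_two, Real.dist_eq,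
    Real.dist_eq, sq_abs, sq_abs, hx, hx, hy, hy] at h
  rw [Real.cos_sub] at hcos
  nlinarith [Real.sin_sq_add_cos_sq (t i), Real.sin_sq_add_cos_sq (t j)]
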